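/- There exists a Steiner triple system of order 49 admitting a strict 5-bicoloring whose color classes have sizes 1, 4, 4, 20 and 20, that is, a partition of its 49 points into classes of sizes 1, 4, 4, 20 and 20 such that every block intersects exactly two of the classes. -/

import Mathlib

/-- `(V, B)` is a Steiner triple system: every block is a 3-element subset of `V`,
and every pair of distinct points of `V` lies in exactly one block. -/
def IsSTS (V : Finset ℕ) (B : Finset (Finset ℕ)) : Prop :=
  (∀ b ∈ B, b.card = 3 ∧ b ⊆ V) ∧
  ∀ x ∈ V, ∀ y ∈ V, x ≠ y → ∃! b, b ∈ B ∧ x ∈ b ∧ y ∈ b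

/-- The triples `{x, y, t x y}` for distinct `x, y` in `V`. -/
def tripleBlocks (V : Finset ℕ) (t : ℕ → ℕ → ℕ) : Finset (Finset ℕ) :=
  V.offDiag.image fun p => {p.1, p.2, t p.1 p.2}

/-- A binary operation satisfying the laws of a Steiner quasigroup on distinct points
defines a Steiner triple system. -/
theorem isSTS_tripleBlocks (V : Finset ℕ) (t : ℕ → ℕ → ℕ)
    (h : ∀ x ∈ V, ∀ y ∈ V, x ≠ y →
      t x y ∈ V ∧ t x y ≠ x ∧ t x y ≠ y ∧ t y x = t x y ∧ t x (t x y) = y) :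
    IsSTS V (tripleBlocks V t) := by
  refine ⟨fun b hb => ?_, fun x hx y hy hxy => ?_⟩
  · simp only [tripleBlocks, Finset.mem_image, Finset.mem_offDiag] at hb
    obtain ⟨⟨u, v⟩, ⟨hu, hv, huv⟩, rfl⟩ := hb
    obtain ⟨hm, h1, h2, -, -⟩ := h u hu v hv huv
    refine ⟨Finset.card_eq_three.2 ⟨u, v, t u v, huv, h1.symm, h2.symm, rfl⟩, ?_⟩
    simp only [Finset.insert_subset_iff, Finset.singleton_subset_iff]
    exact ⟨hu, hv, hm⟩
  · refine ⟨{x, y, t x y}, ⟨?_, by simp, by simp⟩, ?_⟩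
    · exact Finset.mem_image.2 ⟨(x, y), Finset.mem_offDiag.2 ⟨hx, hy, hxy⟩, rfl⟩
    · rintro b ⟨hb, hxb, hyb⟩
      simp only [tripleBlocks, Finset.mem_image, Finset.mem_offDiag] at hb
      obtain ⟨⟨u, v⟩, ⟨hu, hv, huv⟩, rfl⟩ := hb
      obtain ⟨hm, h1, h2, h3, h4⟩ := h u hu v hv huv
      obtain ⟨-, -, -, -, h5⟩ := h v hv u hu huv.symm
      obtain ⟨-, -, -, h6, -⟩ := h u hu _ hm h1.symm
      obtain ⟨-, -, -, h7, -⟩ := h v hv _ hm h2.symm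
      rw [h3] at h5
      simp only [Finset.mem_insert, Finset.mem_singleton] at hxb hyb
      ext z
      simp only [Finset.mem_insert, Finset.mem_singleton]
      rcases hxb with rfl | rfl | rfl <;> rcases hyb with rfl | rfl | rfl <;> grind

/-- Row `x`, column `y` holds the third point of the block through `x` and `y`. The point `0`
is the singleton class; `1`–`4`, `5`–`8`, `9`–`28` and `29`–`48` are the other classes. The
points `0`–`8` form a subsystem, fixed by an automorphism of order five that rotates each of
the blocks `9`–`13`, …, `44`–`48` of five consecutive points. -/
def thirdPointTable : List (List ℕ) :=
  [[0, 2, 1, 4, 3, 8, 7, 6, 5, 14, 15, 16, 17, 18, 9, 10, 11, 12, 13, 24, 25, 26, 27, 28, 19,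
    20, 21, 22, 23, 34, 35, 36, 37, 38, 29, 30, 31, 32, 33, 45, 46, 47, 48, 44, 43, 39, 40, 41,
    42],
   [2, 1, 0, 8, 6, 7, 4, 5, 3, 15, 16, 17, 18, 14, 13, 9, 10, 11, 12, 26, 27, 28, 24, 25, 22,
    23, 19, 20, 21, 36, 37, 38, 34, 35, 32, 33, 29, 30, 31, 47, 48, 44, 45, 46, 41, 42, 43, 39,
    40],
   [1, 0, 2, 7, 5, 4, 8, 3, 6, 16, 17, 18, 14, 15, 12, 13, 9, 10, 11, 27, 28, 24, 25, 26, 21,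
    22, 23, 19, 20, 37, 38, 34, 35, 36, 31, 32, 33, 29, 30, 48, 44, 45, 46, 47, 40, 41, 42, 43,
    39],
   [4, 8, 7, 3, 0, 6, 5, 2, 1, 20, 21, 22, 23, 19, 24, 25, 26, 27, 28, 13, 9, 10, 11, 12, 14,
    15, 16, 17, 18, 39, 40, 41, 42, 43, 45, 46, 47, 48, 44, 29, 30, 31, 32, 33, 38, 34, 35, 36,
    37],
   [3, 6, 5, 0, 4, 2, 1, 8, 7, 22, 23, 19, 20, 21, 25, 26, 27, 28, 24, 11, 12, 13, 9, 10, 18,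
    14, 15, 16, 17, 42, 43, 39, 40, 41, 47, 48, 44, 45, 46, 31, 32, 33, 29, 30, 36, 37, 38, 34,
    35],
   [8, 7, 4, 6, 2, 5, 3, 1, 0, 23, 19, 20, 21, 22, 28, 24, 25, 26, 27, 10, 11, 12, 13, 9, 15,
    16, 17, 18, 14, 43, 39, 40, 41, 42, 48, 44, 45, 46, 47, 30, 31, 32, 33, 29, 35, 36, 37, 38,
    34],
   [7, 4, 8, 5, 1, 3, 6, 0, 2, 24, 25, 26, 27, 28, 19, 20, 21, 22, 23, 14, 15, 16, 17, 18, 9,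
    10, 11, 12, 13, 45, 46, 47, 48, 44, 39, 40, 41, 42, 43, 34, 35, 36, 37, 38, 33, 29, 30, 31,
    32],
   [6, 5, 3, 2, 8, 1, 0, 7, 4, 25, 26, 27, 28, 24, 20, 21, 22, 23, 19, 18, 14, 15, 16, 17, 13,
    9, 10, 11, 12, 47, 48, 44, 45, 46, 41, 42, 43, 39, 40, 37, 38, 34, 35, 36, 31, 32, 33, 29,
    30],
   [5, 3, 6, 1, 7, 0, 2, 4, 8, 26, 27, 28, 24, 25, 23, 19, 20, 21, 22, 15, 16, 17, 18, 14, 12,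
    13, 9, 10, 11, 48, 44, 45, 46, 47, 42, 43, 39, 40, 41, 36, 37, 38, 34, 35, 30, 31, 32, 33,
    29],
   [14, 15, 16, 20, 22, 23, 24, 25, 26, 9, 42, 35, 38, 41, 0, 1, 2, 46, 48, 47, 3, 43, 4, 5, 6,
    7, 8, 33, 31, 32, 45, 28, 29, 27, 44, 11, 37, 36, 12, 40, 39, 13, 10, 21, 34, 30, 17, 19,
    18],
   [15, 16, 17, 21, 23, 19, 25, 26, 27, 42, 10, 43, 36, 34, 44, 0, 1, 2, 47, 5, 48, 3, 39, 4,
    32, 6, 7, 8, 29, 28, 33, 46, 24, 30, 13, 45, 12, 38, 37, 22, 41, 40, 9, 11, 14, 35, 31, 18,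
    20],
   [16, 17, 18, 22, 19, 20, 26, 27, 28, 35, 43, 11, 39, 37, 48, 45, 0, 1, 2, 4, 5, 44, 3, 40,
    30, 33, 6, 7, 8, 31, 24, 29, 47, 25, 38, 9, 46, 13, 34, 12, 23, 42, 41, 10, 21, 15, 36, 32,
    14],
   [17, 18, 14, 23, 20, 21, 27, 28, 24, 38, 36, 39, 12, 40, 2, 44, 46, 0, 1, 41, 4, 5, 45, 3,
    8, 31, 29, 6, 7, 26, 32, 25, 30, 48, 35, 34, 10, 47, 9, 11, 13, 19, 43, 42, 15, 22, 16, 37,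
    33],
   [18, 14, 15, 19, 21, 22, 28, 24, 25, 41, 34, 37, 40, 13, 1, 2, 45, 47, 0, 3, 42, 4, 5, 46,
    7, 8, 32, 30, 6, 44, 27, 33, 26, 31, 10, 36, 35, 11, 48, 43, 12, 9, 20, 39, 29, 16, 23, 17,
    38],
   [9, 13, 12, 24, 25, 28, 19, 20, 23, 0, 44, 48, 2, 1, 14, 32, 43, 41, 31, 6, 7, 38, 37, 8, 3,
    4, 35, 34, 5, 33, 36, 18, 15, 29, 27, 26, 30, 22, 21, 42, 45, 17, 39, 16, 10, 40, 47, 46,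
    11],
   [10, 9, 13, 25, 26, 24, 20, 21, 19, 1, 0, 45, 44, 2, 32, 15, 33, 39, 42, 8, 6, 7, 34, 38, 5,
    3, 4, 36, 35, 30, 29, 37, 14, 16, 22, 28, 27, 31, 23, 17, 43, 46, 18, 40, 12, 11, 41, 48,
    47],
   [11, 10, 9, 26, 27, 25, 21, 22, 20, 2, 1, 0, 46, 45, 43, 33, 16, 29, 40, 34, 8, 6, 7, 35,
    36, 5, 3, 4, 37, 17, 31, 30, 38, 15, 19, 23, 24, 28, 32, 41, 18, 39, 47, 14, 48, 13, 12, 42,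
    44],
   [12, 11, 10, 27, 28, 26, 22, 23, 21, 46, 2, 1, 0, 47, 41, 39, 29, 17, 30, 36, 35, 8, 6, 7,
    38, 37, 5, 3, 4, 16, 18, 32, 31, 34, 33, 20, 19, 25, 24, 15, 42, 14, 40, 48, 45, 44, 9, 13,
    43],
   [13, 12, 11, 28, 24, 27, 23, 19, 22, 48, 47, 2, 1, 0, 31, 42, 40, 30, 18, 7, 37, 36, 8, 6,
    4, 34, 38, 5, 3, 35, 17, 14, 33, 32, 25, 29, 21, 20, 26, 44, 16, 43, 15, 41, 39, 46, 45, 10,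
    9],
   [24, 26, 27, 13, 11, 10, 14, 18, 15, 47, 5, 4, 41, 3, 6, 8, 34, 36, 7, 19, 30, 45, 48, 29,
    0, 40, 1, 2, 33, 23, 20, 42, 39, 28, 16, 38, 17, 43, 35, 32, 25, 12, 31, 37, 46, 21, 44, 9,
    22],
   [25, 27, 28, 9, 12, 11, 15, 14, 16, 3, 48, 5, 4, 42, 7, 6, 8, 35, 37, 30, 20, 31, 46, 44,
    29, 0, 41, 1, 2, 24, 19, 21, 43, 40, 36, 17, 34, 18, 39, 38, 33, 26, 13, 32, 23, 47, 22, 45,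
    10],
   [26, 28, 24, 10, 13, 12, 16, 15, 17, 43, 3, 44, 5, 4, 38, 7, 6, 8, 36, 45, 31, 21, 32, 47,
    2, 30, 0, 42, 1, 41, 25, 20, 22, 39, 40, 37, 18, 35, 14, 33, 34, 29, 27, 9, 11, 19, 48, 23,
    46],
   [27, 24, 25, 11, 9, 13, 17, 16, 18, 4, 39, 3, 45, 5, 37, 34, 7, 6, 8, 48, 46, 32, 22, 33, 1,
    2, 31, 0, 43, 40, 42, 26, 21, 23, 15, 41, 38, 14, 36, 10, 29, 35, 30, 28, 47, 12, 20, 44,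
    19],
   [28, 25, 26, 12, 10, 9, 18, 17, 14, 5, 4, 40, 3, 46, 8, 38, 35, 7, 6, 29, 44, 47, 33, 23,
    39, 1, 2, 32, 0, 19, 41, 43, 27, 22, 37, 16, 42, 34, 15, 24, 11, 30, 36, 31, 20, 48, 13, 21,
    45],
   [19, 22, 21, 14, 18, 15, 9, 13, 12, 6, 32, 30, 8, 7, 3, 5, 36, 38, 4, 0, 29, 2, 1, 39, 24,
    48, 40, 43, 47, 20, 11, 35, 10, 45, 46, 31, 16, 41, 17, 23, 26, 37, 44, 27, 42, 33, 34, 28,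
    25],
   [20, 23, 22, 15, 14, 16, 10, 9, 13, 7, 6, 33, 31, 8, 4, 3, 5, 37, 34, 40, 0, 30, 2, 1, 48,
    25, 44, 41, 39, 46, 21, 12, 36, 11, 18, 47, 32, 17, 42, 28, 19, 27, 38, 45, 26, 43, 29, 35,
    24],
   [21, 19, 23, 16, 15, 17, 11, 10, 9, 8, 7, 6, 29, 32, 35, 4, 3, 5, 38, 1, 41, 0, 31, 2, 40,
    44, 26, 45, 42, 12, 47, 22, 13, 37, 43, 14, 48, 33, 18, 46, 24, 20, 28, 34, 25, 27, 39, 30,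
    36],
   [22, 20, 19, 17, 16, 18, 12, 11, 10, 33, 8, 7, 6, 30, 34, 36, 4, 3, 5, 2, 1, 42, 0, 32, 43,
    41, 45, 27, 46, 38, 13, 48, 23, 9, 14, 39, 15, 44, 29, 35, 47, 25, 21, 24, 37, 26, 28, 40,
    31],
   [23, 21, 20, 18, 17, 14, 13, 12, 11, 31, 29, 8, 7, 6, 5, 35, 37, 4, 3, 33, 2, 1, 43, 0, 47,
    39, 42, 46, 28, 10, 34, 9, 44, 19, 30, 15, 40, 16, 45, 25, 36, 48, 26, 22, 32, 38, 27, 24,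
    41],
   [34, 36, 37, 39, 42, 43, 45, 47, 48, 32, 28, 31, 26, 44, 33, 30, 17, 16, 35, 23, 24, 41, 40,
    19, 20, 46, 12, 38, 10, 29, 15, 11, 9, 14, 0, 18, 1, 2, 27, 3, 22, 21, 4, 5, 13, 6, 25, 7,
    8],
   [35, 37, 38, 40, 43, 39, 46, 48, 44, 45, 33, 24, 32, 27, 36, 29, 31, 18, 17, 20, 19, 25, 42,
    41, 11, 21, 47, 13, 34, 15, 30, 16, 12, 10, 28, 0, 14, 1, 2, 5, 3, 23, 22, 4, 8, 9, 6, 26,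
    7],
   [36, 38, 34, 41, 39, 40, 47, 44, 45, 28, 46, 29, 25, 33, 18, 37, 30, 32, 14, 42, 21, 20, 26,
    43, 35, 12, 22, 48, 9, 11, 16, 31, 17, 13, 2, 24, 0, 15, 1, 4, 5, 3, 19, 23, 7, 8, 10, 6,
    27],
   [37, 34, 35, 42, 40, 41, 48, 45, 46, 29, 24, 47, 30, 26, 15, 14, 38, 31, 33, 39, 43, 22, 21,
    27, 10, 36, 13, 23, 44, 9, 12, 17, 32, 18, 1, 2, 25, 0, 16, 19, 4, 5, 3, 20, 28, 7, 8, 11,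
    6],
   [38, 35, 36, 43, 41, 42, 44, 46, 47, 27, 30, 25, 48, 31, 29, 16, 15, 34, 32, 28, 40, 39, 23,
    22, 45, 11, 37, 9, 19, 14, 10, 13, 18, 33, 17, 1, 2, 26, 0, 21, 20, 4, 5, 3, 6, 24, 7, 8,
    12],
   [29, 32, 31, 45, 47, 48, 39, 41, 42, 44, 13, 38, 35, 10, 27, 22, 19, 33, 25, 16, 36, 40, 15,
    37, 46, 18, 43, 14, 30, 0, 28, 2, 1, 17, 34, 12, 20, 23, 11, 6, 21, 7, 8, 26, 9, 3, 24, 4,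
    5],
   [30, 33, 32, 46, 48, 44, 40, 42, 43, 11, 45, 9, 34, 36, 26, 28, 23, 20, 29, 38, 17, 37, 41,
    16, 31, 47, 14, 39, 15, 18, 0, 24, 2, 1, 12, 35, 13, 21, 19, 27, 6, 22, 7, 8, 5, 10, 3, 25,
    4],
   [31, 29, 33, 47, 44, 45, 41, 43, 39, 37, 12, 46, 10, 35, 30, 27, 24, 19, 21, 17, 34, 18, 38,
    42, 16, 32, 48, 15, 40, 1, 14, 0, 25, 2, 20, 13, 36, 9, 22, 8, 28, 6, 23, 7, 4, 5, 11, 3,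
    26],
   [32, 30, 29, 48, 45, 46, 42, 39, 40, 36, 38, 13, 47, 11, 22, 31, 28, 25, 20, 43, 18, 35, 14,
    34, 41, 17, 33, 44, 16, 2, 1, 15, 0, 26, 23, 21, 9, 37, 10, 7, 8, 24, 6, 19, 27, 4, 5, 12,
    3],
   [33, 31, 30, 44, 46, 47, 43, 40, 41, 12, 37, 34, 9, 48, 21, 23, 32, 24, 26, 35, 39, 14, 36,
    15, 17, 42, 18, 29, 45, 27, 2, 1, 16, 0, 11, 19, 22, 10, 38, 20, 7, 8, 25, 6, 3, 28, 4, 5,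
    13],
   [45, 47, 48, 29, 31, 30, 34, 37, 36, 40, 22, 12, 11, 43, 42, 17, 41, 15, 44, 32, 38, 33, 10,
    24, 23, 28, 46, 35, 25, 3, 5, 4, 19, 21, 6, 27, 8, 7, 20, 39, 9, 16, 14, 13, 18, 0, 26, 1,
    2],
   [46, 48, 44, 30, 32, 31, 35, 38, 37, 39, 41, 23, 13, 12, 45, 43, 18, 42, 16, 25, 33, 34, 29,
    11, 26, 19, 24, 47, 36, 22, 3, 5, 4, 20, 21, 6, 28, 8, 7, 9, 40, 10, 17, 15, 2, 14, 0, 27,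
    1],
   [47, 44, 45, 31, 33, 32, 36, 34, 38, 13, 40, 42, 19, 9, 17, 46, 39, 14, 43, 12, 26, 29, 35,
    30, 37, 27, 20, 25, 48, 21, 23, 3, 5, 4, 7, 22, 6, 24, 8, 16, 10, 41, 11, 18, 1, 2, 15, 0,
    28],
   [48, 45, 46, 32, 29, 33, 37, 35, 34, 10, 9, 41, 43, 20, 39, 18, 47, 40, 15, 31, 13, 27, 30,
    36, 44, 38, 28, 21, 26, 4, 22, 19, 3, 5, 8, 7, 23, 6, 25, 14, 17, 11, 42, 12, 24, 1, 2, 16,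
    0],
   [44, 46, 47, 33, 30, 29, 38, 36, 35, 21, 11, 10, 42, 39, 16, 40, 14, 48, 41, 37, 32, 9, 28,
    31, 27, 45, 34, 24, 22, 5, 4, 23, 20, 3, 26, 8, 7, 19, 6, 13, 15, 18, 12, 43, 0, 25, 1, 2,
    17],
   [43, 41, 40, 38, 36, 35, 33, 31, 30, 34, 14, 21, 15, 29, 10, 12, 48, 45, 39, 46, 23, 11, 47,
    20, 42, 26, 25, 37, 32, 13, 8, 7, 28, 6, 9, 5, 4, 27, 3, 18, 2, 1, 24, 0, 44, 17, 19, 22,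
    16],
   [39, 42, 41, 34, 37, 36, 29, 32, 31, 30, 35, 15, 22, 16, 40, 11, 13, 44, 46, 21, 47, 19, 12,
    48, 33, 43, 27, 26, 38, 6, 9, 8, 7, 24, 3, 10, 5, 4, 28, 0, 14, 2, 1, 25, 17, 45, 18, 20,
    23],
   [40, 43, 42, 35, 38, 37, 30, 33, 32, 17, 31, 36, 16, 23, 47, 41, 12, 9, 45, 44, 22, 48, 20,
    13, 34, 29, 39, 28, 27, 25, 6, 10, 8, 7, 24, 3, 11, 5, 4, 26, 0, 15, 2, 1, 19, 18, 46, 14,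
    21],
   [41, 39, 43, 36, 34, 38, 31, 29, 33, 19, 18, 32, 37, 17, 46, 48, 42, 13, 10, 9, 45, 23, 44,
    21, 28, 35, 30, 40, 24, 7, 26, 6, 11, 8, 4, 25, 3, 12, 5, 1, 27, 0, 16, 2, 22, 20, 14, 47,
    15],
   [42, 40, 39, 37, 35, 34, 32, 30, 29, 18, 20, 14, 33, 38, 11, 47, 44, 43, 9, 22, 10, 46, 19,
    45, 25, 24, 36, 31, 41, 8, 7, 27, 6, 12, 5, 4, 26, 3, 13, 2, 1, 28, 0, 17, 16, 23, 21, 15,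
    48]]

/-- The third point of the block through `x` and `y`. -/
def thirdPoint (x y : ℕ) : ℕ := (thirdPointTable.getD x []).getD y 0

theorem thirdPoint_laws : ∀ x ∈ Finset.range 49, ∀ y ∈ Finset.range 49, x ≠ y →
    thirdPoint x y ∈ Finset.range 49 ∧ thirdPoint x y ≠ x ∧ thirdPoint x y ≠ y ∧
      thirdPoint y x = thirdPoint x y ∧ thirdPoint x (thirdPoint x y) = y := by
  simp only [Finset.mem_range]
  decide +kernel

/-- The colour class of a point of the system given by `thirdPoint`. -/
def colour (x : ℕ) : ℕ :=
  if x < 1 then 0 else if x < 5 then 1 else if x < 9 then 2 else if x < 29 then 3 else 4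

/-- Of three points, exactly two share a colour. -/
theorem colour_thirdPoint : ∀ x < 49, ∀ y < 49, x ≠ y →
    (colour x = colour y ∧ colour (thirdPoint x y) ≠ colour x) ∨
    (colour x = colour (thirdPoint x y) ∧ colour y ≠ colour x) ∨
    (colour y = colour (thirdPoint x y) ∧ colour y ≠ colour x) := by
  decide +kernel

/-- The points below `49` of colour `c`. -/
def colourClass (c : ℕ) : Finset ℕ := (Finset.range 49).filter fun x => colour x = c

theorem disjoint_colourClass {c d : ℕ} (h : c ≠ d) :
    Disjoint (colourClass c) (colourClass d) :=
  Finset.disjoint_filter.2 fun _ _ hc hd => h (hc.symm.trans hd)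

theorem colour_lt_five (x : ℕ) : colour x < 5 := by
  unfold colour
  split_ifs <;> decide

theorem triple_inter_colourClass_nonempty {x y z : ℕ} (hx : x < 49) (hy : y < 49) (hz : z < 49)
    (c : ℕ) : (({x, y, z} : Finset ℕ) ∩ colourClass c).Nonempty ↔
      colour x = c ∨ colour y = c ∨ colour z = c := by
  simp only [Finset.Nonempty, Finset.mem_inter, Finset.mem_insert, Finset.mem_singleton,
    colourClass, Finset.mem_filter, Finset.mem_range]
  constructor
  · rintro ⟨w, rfl | rfl | rfl, -, h⟩ <;> simp [h]
  · rintro (h | h | h)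
    exacts [⟨x, by simp, hx, h⟩, ⟨y, by simp, hy, h⟩, ⟨z, by simp, hz, h⟩]

theorem two_of_five : ∀ a < 5, ∀ b < 5, ∀ c < 5,
    (a = b ∧ c ≠ a) ∨ (a = c ∧ b ≠ a) ∨ (b = c ∧ b ≠ a) →
    (((if a = 0 ∨ b = 0 ∨ c = 0 then 1 else 0) +
      (if a = 1 ∨ b = 1 ∨ c = 1 then 1 else 0) +
      (if a = 2 ∨ b = 2 ∨ c = 2 then 1 else 0) +
      (if a = 3 ∨ b = 3 ∨ c = 3 then 1 else 0) +
      (if a = 4 ∨ b = 4 ∨ c = 4 then 1 else 0) : ℕ) = 2) := by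
  intro a ha b hb c hc h
  rcases h with ⟨rfl, h⟩ | ⟨rfl, h⟩ | ⟨rfl, h⟩
  · interval_cases a <;> interval_cases c <;> simp_all
  · interval_cases a <;> interval_cases b <;> simp_all
  · interval_cases a <;> interval_cases b <;> simp_all

theorem stmt_19 :
    ∃ (V : Finset ℕ) (B : Finset (Finset ℕ)),
      V.card = 49 ∧ IsSTS V B ∧
      ∃ X1 X2 X3 X4 X5 : Finset ℕ,
        X1.card = 1 ∧
        X2.card = 4 ∧
        X3.card = 4 ∧
        X4.card = 20 ∧
        X5.card = 20 ∧
        Disjoint X1 X2 ∧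
        Disjoint X1 X3 ∧
        Disjoint X1 X4 ∧
        Disjoint X1 X5 ∧
        Disjoint X2 X3 ∧
        Disjoint X2 X4 ∧
        Disjoint X2 X5 ∧
        Disjoint X3 X4 ∧
        Disjoint X3 X5 ∧
        Disjoint X4 X5 ∧
        X1 ∪ X2 ∪ X3 ∪ X4 ∪ X5 = V ∧
        ∀ b ∈ B,
          (((if (b ∩ X1).Nonempty then 1 else 0) +
           (if (b ∩ X2).Nonempty then 1 else 0) +
           (if (b ∩ X3).Nonempty then 1 else 0) +
           (if (b ∩ X4).Nonempty then 1 else 0) +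
           (if (b ∩ X5).Nonempty then 1 else 0) : ℕ) = 2) := by
  refine ⟨Finset.range 49, tripleBlocks (Finset.range 49) thirdPoint, Finset.card_range 49,
    isSTS_tripleBlocks _ _ thirdPoint_laws, colourClass 0, colourClass 1, colourClass 2,
    colourClass 3, colourClass 4, by decide +kernel, by decide +kernel, by decide +kernel,
    by decide +kernel, by decide +kernel, ?_⟩
  refine ⟨disjoint_colourClass (by decide), disjoint_colourClass (by decide),
    disjoint_colourClass (by decide), disjoint_colourClass (by decide),
    disjoint_colourClass (by decide), disjoint_colourClass (by decide),
    disjoint_colourClass (by decide), disjoint_colourClass (by decide),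
    disjoint_colourClass (by decide), disjoint_colourClass (by decide),
    by decide +kernel, fun b hb => ?_⟩
  simp only [tripleBlocks, Finset.mem_image, Finset.mem_offDiag] at hb
  obtain ⟨⟨x, y⟩, ⟨hx, hy, hxy⟩, rfl⟩ := hb
  have hz := (thirdPoint_laws x hx y hy hxy).1
  rw [Finset.mem_range] at hx hy hz
  simp only [triple_inter_colourClass_nonempty hx hy hz]
  exact two_of_five _ (colour_lt_five x) _ (colour_lt_five y) _ (colour_lt_five _)
    (colour_thirdPoint x hx y hy hxy)
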